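/- arXiv:1609.01220 — 7 statements merged into one kernel-verified Lean document; each statement's English description precedes it below -/
import Mathlib

section
/- Let c and c' be two Deflate codings on the alphabet Fin n such that for every x : Fin n the lengths of c x and c' x agree. Then c x = c' x for every x : Fin n. -/
/-- Lexicographic order on bit strings (false = 0, true = 1). -/
inductive BitLex : List Bool → List Bool → Prop
  | nil (b : List Bool) : BitLex [] b
  | false_true (a b : List Bool) : BitLex (false :: a) (true :: b)
  | cons (j : Bool) (a b : List Bool) : BitLex a b → BitLex (j :: a) (j :: b)

/-- A Deflate coding on the alphabet `Fin n`. -/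
def DeflateCoding {n : ℕ} (c : Fin n → List Bool) : Prop :=
  (∀ a b : Fin n, a ≠ b → c a ≠ [] → ¬ (c a <+: c b)) ∧
  (∀ a b : Fin n, (c a).length < (c b).length → BitLex (c a) (c b)) ∧
  (∀ a b : Fin n, (c a).length = (c b).length → a ≤ b → BitLex (c a) (c b)) ∧
  (∀ (a : Fin n) (l : List Bool), l ≠ [] → BitLex l (c a) → l.length = (c a).length →
    ∃ b : Fin n, c b ≠ [] ∧ c b <+: l)

/-- The Kraft sum of a coding, computed in ℚ. -/
def kraftSum {n : ℕ} (c : Fin n → List Bool) : ℚ :=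
  ∑ i ∈ Finset.univ.filter (fun i : Fin n => c i ≠ []), (1 / 2 : ℚ) ^ (c i).length

theorem bitLex_total (a b : List Bool) : BitLex a b ∨ BitLex b a := by
  induction a generalizing b with
  | nil => exact Or.inl (BitLex.nil b)
  | cons i a ih =>
    cases b with
    | nil => exact Or.inr (BitLex.nil _)
    | cons j b =>
      cases i <;> cases j
      · exact (ih b).imp (BitLex.cons _ _ _) (BitLex.cons _ _ _)
      · exact Or.inl (BitLex.false_true _ _)
      · exact Or.inr (BitLex.false_true _ _)
      · exact (ih b).imp (BitLex.cons _ _ _) (BitLex.cons _ _ _)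

theorem bitLex_antisymm {a b : List Bool} (h : BitLex a b) (h' : BitLex b a) : a = b := by
  induction h with
  | nil b => cases h'; rfl
  | false_true a b => cases h'
  | cons j a b _ ih =>
    cases h' with
    | cons _ _ _ h => rw [ih h]

theorem uniqueness_step {n : ℕ} (c c' : Fin n → List Bool)
    (hc : DeflateCoding c) (hc' : DeflateCoding c')
    (hlen : ∀ x : Fin n, (c x).length = (c' x).length) (x : Fin n)
    (h1 : ∀ y, (c y).length < (c x).length → c y = c' y)
    (h2 : ∀ y, (c y).length = (c x).length → y < x → c y = c' y)
    (hle : BitLex (c x) (c' x)) : c x = c' x := by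
  by_cases hx : c x = []
  · have h := hlen x
    rw [hx] at h ⊢
    exact (List.length_eq_zero_iff.mp h.symm).symm
  obtain ⟨b, hb, hp⟩ := hc'.2.2.2 x (c x) hx hle (hlen x)
  have hl := hp.length_le
  rw [← hlen b] at hl
  have key : c b = c' b → b ≠ x → False := fun he hne =>
    hc.1 b x hne (he ▸ hb) (he ▸ hp)
  rcases hl.lt_or_eq with hlt | heq
  · exact (key (h1 b hlt) (by rintro rfl; exact lt_irrefl _ hlt)).elim
  · have hbx : c' b = c x := hp.eq_of_length (by rw [← hlen b, heq])
    rcases lt_or_ge b x with hlt | hge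
    · exact (key (h2 b heq hlt) hlt.ne).elim
    · have := hc'.2.2.1 x b (by rw [← hlen, ← hlen, heq]) hge
      rw [hbx] at this
      exact bitLex_antisymm hle this

theorem uniqueness {n : ℕ} (c c' : Fin n → List Bool)
    (hc : DeflateCoding c) (hc' : DeflateCoding c')
    (hlen : ∀ x : Fin n, (c x).length = (c' x).length) :
    ∀ x : Fin n, c x = c' x := by
  have main : ∀ L i : ℕ, ∀ x : Fin n, (c x).length = L → x.val = i → c x = c' x := by
    intro L
    induction L using Nat.strong_induction_on with
    | _ L ihL =>
    intro i
    induction i using Nat.strong_induction_on with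
    | _ i ihi =>
    intro x hL hi
    have h1 : ∀ y, (c y).length < (c x).length → c y = c' y := fun y hy =>
      ihL _ (hL ▸ hy) y.val y rfl rfl
    have h2 : ∀ y, (c y).length = (c x).length → y < x → c y = c' y := fun y hy hyx =>
      ihi y.val (hi ▸ hyx) y (hy.trans hL) rfl
    rcases bitLex_total (c x) (c' x) with h | h
    · exact uniqueness_step c c' hc hc' hlen x h1 h2 h
    · refine (uniqueness_step c' c hc' hc (fun y => (hlen y).symm) x ?_ ?_ h).symm
      · intro y hy
        exact (h1 y (by rwa [hlen, hlen])).symm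
      · intro y hy hyx
        exact (h2 y (by rwa [hlen, hlen]) hyx).symm
  intro x
  exact main _ _ x rfl rfl
end

section
/- Let c be a Deflate coding on the alphabet Fin n. Then the Kraft sum ∑_{i : Fin n, c i ≠ []} (1/2)^(length (c i)) (a sum of rationals) is at most 1. -/
theorem kraft_aux {n : ℕ} (N : ℕ) : ∀ (s : Finset (Fin n)) (f : Fin n → List Bool),
    (∀ i ∈ s, (f i).length ≤ N) →
    (∀ i ∈ s, ∀ j ∈ s, i ≠ j → ¬ (f i <+: f j)) →
    ∑ i ∈ s, (1 / 2 : ℚ) ^ (f i).length ≤ 1 := by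
  induction N with
  | zero =>
    intro s f hl hp
    have hcard : s.card ≤ 1 := by
      rw [Finset.card_le_one]
      intro a ha b hb
      by_contra hab
      have h0 : f a = [] := List.eq_nil_of_length_eq_zero (Nat.le_zero.mp (hl a ha))
      exact hp a ha b hb hab (h0 ▸ List.nil_prefix)
    calc ∑ i ∈ s, (1 / 2 : ℚ) ^ (f i).length ≤ ∑ i ∈ s, (1 : ℚ) :=
          Finset.sum_le_sum fun i _ => pow_le_one₀ (by norm_num) (by norm_num)
      _ ≤ 1 := by simpa using hcard
  | succ N ih =>
    intro s f hl hp
    by_cases hnil : ∃ i ∈ s, f i = []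
    · obtain ⟨i, hi, h0⟩ := hnil
      have hs : s = {i} := by
        ext j
        rw [Finset.mem_singleton]
        constructor
        · intro hj
          by_contra hij
          exact hp i hi j hj (Ne.symm hij) (h0 ▸ List.nil_prefix)
        · rintro rfl
          exact hi
      rw [hs, Finset.sum_singleton, h0]
      simp
    · push Not at hnil
      have key : ∀ b : Bool, ∑ i ∈ s with (f i).head? = some b,
          (1 / 2 : ℚ) ^ (f i).length ≤ 1 / 2 := by
        intro b
        have hc : ∀ i ∈ s.filter (fun i => (f i).head? = some b), f i = b :: (f i).tail := by
          intro i hi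
          have := (Finset.mem_filter.mp hi).2
          cases h : f i <;> simp_all
        have h1 := ih (s.filter (fun i => (f i).head? = some b)) (fun i => (f i).tail)
          (by
            intro i hi
            have := hl i (Finset.mem_filter.mp hi).1
            simp only [List.length_tail]
            omega)
          (by
            intro i hi j hj hij hpre
            apply hp i (Finset.mem_filter.mp hi).1 j (Finset.mem_filter.mp hj).1 hij
            rw [hc i hi, hc j hj]
            exact (List.prefix_cons_inj b).mpr hpre)
        have h2 : ∑ i ∈ s with (f i).head? = some b, (1 / 2 : ℚ) ^ (f i).length
            = (1 / 2) * ∑ i ∈ s with (f i).head? = some b,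
              (1 / 2 : ℚ) ^ ((f i).tail).length := by
          rw [Finset.mul_sum]
          refine Finset.sum_congr rfl fun i hi => ?_
          rw [← pow_succ', ← List.length_cons (a := b), ← hc i hi]
        rw [h2]
        linarith
      have hsplit := Finset.sum_filter_add_sum_filter_not s
        (fun i => (f i).head? = some true) (fun i => (1 / 2 : ℚ) ^ (f i).length)
      have heq : s.filter (fun i => ¬ (f i).head? = some true)
          = s.filter (fun i => (f i).head? = some false) := by
        refine Finset.filter_congr fun i hi => ?_
        have := hnil i hi
        cases h : f i with
        | nil => exact absurd h this
        | cons x t => cases x <;> simp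
      rw [heq] at hsplit
      have := key true
      have := key false
      linarith

theorem kraft_ineq {n : ℕ} (c : Fin n → List Bool) (hc : DeflateCoding c) :
    kraftSum c ≤ 1 := by
  unfold kraftSum
  refine kraft_aux (Finset.univ.sup fun i => (c i).length) _ c
    (fun i _ => Finset.le_sup (f := fun i => (c i).length) (Finset.mem_univ i)) ?_
  intro i hi j _ hij
  exact hc.1 i j hij (Finset.mem_filter.mp hi).2
end

section
/- Let c be a Deflate coding on the alphabet Fin n. Then the Kraft sum ∑_{i : Fin n, c i ≠ []} (1/2)^(length (c i)) equals 1 if and only if there exists k : Fin n such that c k is nonempty and every bit of c k is 1 (i.e., c k = List.replicate (length (c k)) true with length (c k) > 0). -/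
/-- All bit strings of length `N`. -/
def bitStrings (N : ℕ) : Finset (List Bool) :=
  (Finset.univ : Finset (List.Vector Bool N)).image List.Vector.toList

theorem mem_bitStrings (N : ℕ) (l : List Bool) : l ∈ bitStrings N ↔ l.length = N := by
  unfold bitStrings
  simp only [Finset.mem_image, Finset.mem_univ, true_and]
  constructor
  · rintro ⟨v, rfl⟩
    exact v.2
  · intro h
    exact ⟨⟨l, h⟩, rfl⟩

theorem card_bitStrings (N : ℕ) : (bitStrings N).card = 2 ^ N := by
  unfold bitStrings
  rw [Finset.card_image_of_injective _ List.Vector.toList_injective]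
  simp [card_vector]

theorem bitLex_replicate_true (l : List Bool) : BitLex l (List.replicate l.length true) := by
  induction l with
  | nil => exact BitLex.nil _
  | cons b l ih =>
    rw [List.length_cons, List.replicate_succ]
    cases b
    · exact BitLex.false_true _ _
    · exact BitLex.cons _ _ _ ih

/-- The strings of length `N` that have a nonempty codeword as prefix. -/
def covered {n : ℕ} (c : Fin n → List Bool) (N : ℕ) : Finset (List Bool) :=
  (Finset.univ.filter (fun i : Fin n => c i ≠ [])).biUnion
    (fun i => (bitStrings (N - (c i).length)).image (fun q => c i ++ q))

theorem mem_covered {n : ℕ} (c : Fin n → List Bool) (N : ℕ)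
    (hN : ∀ i, (c i).length ≤ N) (l : List Bool) :
    l ∈ covered c N ↔ l.length = N ∧ ∃ i, c i ≠ [] ∧ c i <+: l := by
  unfold covered
  simp only [Finset.mem_biUnion, Finset.mem_filter, Finset.mem_univ, true_and, Finset.mem_image,
    mem_bitStrings]
  constructor
  · rintro ⟨i, hi, q, hq, rfl⟩
    have := hN i
    refine ⟨by rw [List.length_append]; omega, i, hi, q, rfl⟩
  · rintro ⟨hl, i, hi, q, rfl⟩
    rw [List.length_append] at hl
    exact ⟨i, hi, q, by omega, rfl⟩

theorem card_covered {n : ℕ} (c : Fin n → List Bool) (N : ℕ)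
    (hN : ∀ i, (c i).length ≤ N)
    (hp : ∀ a b : Fin n, a ≠ b → c a ≠ [] → ¬ (c a <+: c b)) :
    ((covered c N).card : ℚ) = kraftSum c * 2 ^ N := by
  unfold covered kraftSum
  rw [Finset.card_biUnion, Finset.sum_mul]
  · push_cast
    refine Finset.sum_congr rfl fun i _ => ?_
    rw [Finset.card_image_of_injective _ (List.append_right_injective (c i)), card_bitStrings]
    obtain ⟨d, hd⟩ := Nat.exists_eq_add_of_le (hN i)
    rw [hd, Nat.add_sub_cancel_left, pow_add, ← mul_assoc, ← mul_pow]
    norm_num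
  · intro a ha b hb hab
    rw [Finset.mem_coe, Finset.mem_filter] at ha hb
    rw [Function.onFun, Finset.disjoint_left]
    intro l hla hlb
    rw [Finset.mem_image] at hla hlb
    obtain ⟨q, _, hq⟩ := hla
    obtain ⟨r, _, hr⟩ := hlb
    have h1 : c a <+: l := ⟨q, hq⟩
    have h2 : c b <+: l := ⟨r, hr⟩
    rcases List.prefix_or_prefix_of_prefix h1 h2 with h | h
    · exact hp a b hab ha.2 h
    · exact hp b a hab.symm hb.2 h

theorem extended_kraft_ineq_eq {n : ℕ} (c : Fin n → List Bool) (hc : DeflateCoding c) :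
    kraftSum c = 1 ↔
      ∃ k : Fin n, 0 < (c k).length ∧ c k = List.replicate (c k).length true := by
  obtain ⟨hp, -, -, h4⟩ := hc
  obtain ⟨N, hN⟩ : ∃ N, ∀ i, (c i).length ≤ N :=
    ⟨∑ i, (c i).length, fun i =>
      Finset.single_le_sum (f := fun i => (c i).length) (fun _ _ => Nat.zero_le _)
        (Finset.mem_univ i)⟩
  have hcard := card_covered c N hN hp
  have hsub : covered c N ⊆ bitStrings N := fun l hl =>
    (mem_bitStrings N l).2 ((mem_covered c N hN l).1 hl).1
  have hpos : (2 : ℚ) ^ N ≠ 0 := by positivity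
  constructor
  · intro h
    rw [h, one_mul] at hcard
    have hcard' : (covered c N).card = 2 ^ N := by exact_mod_cast hcard
    have heq := Finset.eq_of_subset_of_card_le hsub (by rw [card_bitStrings, hcard'])
    have hm : List.replicate N true ∈ covered c N := by
      rw [heq, mem_bitStrings, List.length_replicate]
    obtain ⟨-, k, hk, hpre⟩ := (mem_covered c N hN _).1 hm
    refine ⟨k, List.length_pos_iff.2 hk, ?_⟩
    rw [List.eq_replicate_iff]
    exact ⟨rfl, fun b hb => List.eq_of_mem_replicate (hpre.subset hb)⟩
  · rintro ⟨k, hk, hrep⟩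
    have heq : covered c N = bitStrings N := by
      refine Finset.Subset.antisymm hsub fun l hl => ?_
      rw [mem_bitStrings] at hl
      rw [mem_covered c N hN]
      refine ⟨hl, ?_⟩
      have hlen : (l.take (c k).length).length = (c k).length := by
        rw [List.length_take, hl]
        exact min_eq_left (hN k)
      have hlex : BitLex (l.take (c k).length) (c k) := by
        have := bitLex_replicate_true (l.take (c k).length)
        rw [hlen, ← hrep] at this
        exact this
      obtain ⟨b, hb, hpre⟩ := h4 k (l.take (c k).length)
        (List.length_pos_iff.1 (by rw [hlen]; exact hk)) hlex hlen
      exact ⟨b, hb, hpre.trans (List.take_prefix _ _)⟩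
    rw [heq, card_bitStrings] at hcard
    push_cast at hcard
    exact mul_right_cancel₀ hpos (by rw [← hcard, one_mul])
end

section
/- Let l : Fin n → ℕ be a length function such that ∑_{i : Fin n, l i ≠ 0} (1/2)^(l i) ≤ 1 (a sum of rationals). Then there exists a Deflate coding c on the alphabet Fin n such that for every x : Fin n, length (c x) = l x. -/
namespace DeflateAux

def val : List Bool → ℕ
  | [] => 0
  | b :: t => (if b then 2 ^ t.length else 0) + val t

def bits : ℕ → ℕ → List Bool
  | 0, _ => []
  | k + 1, v => decide (2 ^ k ≤ v) :: bits k (v % 2 ^ k)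

lemma length_bits (k v : ℕ) : (bits k v).length = k := by
  induction k generalizing v with
  | zero => rfl
  | succ k ih => simp [bits, ih]

lemma val_bits (k v : ℕ) (h : v < 2 ^ k) : val (bits k v) = v := by
  induction k generalizing v with
  | zero => simp at h; simp [bits, val, h]
  | succ k ih =>
    have h2 : 0 < 2 ^ k := by positivity
    simp only [bits, val, length_bits]
    rw [ih _ (Nat.mod_lt _ h2)]
    rw [pow_succ] at h
    by_cases hc : 2 ^ k ≤ v
    · have : v % 2 ^ k = v - 2 ^ k := by
        rw [Nat.mod_eq_sub_mod hc, Nat.mod_eq_of_lt (by omega)]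
      simp [hc, this]
    · simp [hc, Nat.mod_eq_of_lt (not_le.mp hc)]

lemma val_lt (s : List Bool) : val s < 2 ^ s.length := by
  induction s with
  | nil => simp [val]
  | cons b t ih =>
    simp only [val, List.length_cons, pow_succ]
    split_ifs <;> omega

lemma val_append (s t : List Bool) : val (s ++ t) = val s * 2 ^ t.length + val t := by
  induction s with
  | nil => simp [val]
  | cons b s ih =>
    simp only [List.cons_append, val, ih, List.length_append]
    split_ifs <;> ring

lemma val_inj (s t : List Bool) (h : s.length = t.length) (hv : val s = val t) : s = t := by
  induction s generalizing t with
  | nil => exact (List.length_eq_zero_iff.mp h.symm).symm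
  | cons b s ih =>
    cases t with
    | nil => simp at h
    | cons d t =>
      simp only [List.length_cons, Nat.add_right_cancel_iff] at h
      have h1 := val_lt s
      have h2 := val_lt t
      rw [h] at h1
      simp only [val, h] at hv
      cases b <;> cases d <;> simp at hv
      · rw [ih t h hv]
      · omega
      · omega
      · rw [ih t h hv]

lemma prefix_of (s t : List Bool) (h : s.length ≤ t.length)
    (h1 : val s * 2 ^ (t.length - s.length) ≤ val t)
    (h2 : val t < (val s + 1) * 2 ^ (t.length - s.length)) : s <+: t := by
  have e : t = t.take s.length ++ t.drop s.length := (List.take_append_drop _ _).symm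
  have hv := val_append (t.take s.length) (t.drop s.length)
  rw [← e, List.length_drop] at hv
  have h3 := val_lt (t.drop s.length)
  rw [List.length_drop] at h3
  have : s = t.take s.length := by
    apply val_inj
    · simp [h]
    · generalize 2 ^ (t.length - s.length) = p at *
      generalize val (List.take s.length t) = x at *
      apply le_antisymm
      · have : val s * p < (x + 1) * p := by rw [add_mul]; omega
        exact Nat.lt_succ_iff.mp (lt_of_mul_lt_mul_right this (Nat.zero_le _))
      · have : x * p < (val s + 1) * p := by omega
        exact Nat.lt_succ_iff.mp (lt_of_mul_lt_mul_right this (Nat.zero_le _))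
  exact this ▸ List.take_prefix _ _

lemma of_prefix (s t : List Bool) (h : s <+: t) :
    val t < (val s + 1) * 2 ^ (t.length - s.length) := by
  obtain ⟨r, rfl⟩ := h
  have := val_lt r
  rw [val_append]
  simp
  rw [add_mul]
  omega

lemma bitLex_of (s t : List Bool) (h : s.length ≤ t.length)
    (h1 : val s * 2 ^ (t.length - s.length) ≤ val t) : BitLex s t := by
  induction s generalizing t with
  | nil => exact .nil _
  | cons b s ih =>
    cases t with
    | nil => simp at h
    | cons d t =>
      simp only [List.length_cons, Nat.add_le_add_iff_right] at h
      have hp : 2 ^ t.length = 2 ^ s.length * 2 ^ (t.length - s.length) := by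
        rw [← pow_add]; congr 1; omega
      have h2 := val_lt t
      simp only [val, List.length_cons, Nat.add_sub_add_right, add_mul] at h1
      cases b <;> cases d
      · exact .cons _ _ _ (ih t h (by simpa using h1))
      · exact .false_true _ _
      · simp at h1; omega
      · refine .cons _ _ _ (ih t h ?_)
        simp at h1; omega

lemma le_of_bitLex (s t : List Bool) (h : BitLex s t) (hl : s.length = t.length) :
    val s ≤ val t := by
  induction h with
  | nil b => simp [val]
  | false_true a b =>
    have := val_lt a
    simp at hl
    simp [val, ← hl]; omega
  | cons j a b _ ih =>
    simp at hl
    have := ih hl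
    simp [val, hl, this]

lemma locate {ι α : Type*} [DecidableEq ι] [LinearOrder α] (k : ι → α)
    (hk : Function.Injective k) (w : ι → ℕ) (s : Finset ι) (m : ℕ) (hm : m < ∑ i ∈ s, w i) :
    ∃ y ∈ s, ∑ z ∈ s.filter (fun z => k z < k y), w z ≤ m ∧
      m < ∑ z ∈ s.filter (fun z => k z < k y), w z + w y := by
  induction s using Finset.induction_on_max_value k with
  | empty => simp at hm
  | insert a s ha hmax ih =>
    by_cases h : m < ∑ i ∈ s, w i
    · obtain ⟨y, hy, h1⟩ := ih h
      refine ⟨y, Finset.mem_insert_of_mem hy, ?_⟩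
      rw [Finset.filter_insert, if_neg (not_lt.mpr (hmax y hy))]
      exact h1
    · refine ⟨a, Finset.mem_insert_self _ _, ?_⟩
      have : s.filter (fun z => k z < k a) = s := by
        apply Finset.filter_true_of_mem
        intro z hz
        refine lt_of_le_of_ne (hmax z hz) (fun e => ha (hk e ▸ hz))
      rw [Finset.filter_insert, if_neg (lt_irrefl _), this]
      rw [Finset.sum_insert ha] at hm
      omega

variable {n : ℕ} (l : Fin n → ℕ)

def key (x : Fin n) : ℕ ×ₗ Fin n := toLex (l x, x)

lemma key_inj : Function.Injective (key l) := by
  intro a b h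
  exact congrArg (fun p => (ofLex p).2) h

lemma key_lt (a b : Fin n) : key l a < key l b ↔ l a < l b ∨ l a = l b ∧ a < b := by
  simp [key, Prod.Lex.toLex_lt_toLex]

def P (a : Fin n) : Finset (Fin n) :=
  Finset.univ.filter (fun y => l y ≠ 0 ∧ key l y < key l a)

lemma mem_P (a y : Fin n) : y ∈ P l a ↔ l y ≠ 0 ∧ key l y < key l a := by simp [P]

def v (a : Fin n) : ℕ := ∑ y ∈ P l a, 2 ^ (l a - l y)

lemma le_of_key (a b : Fin n) (h : key l a < key l b) : l a ≤ l b := by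
  rw [key_lt] at h; omega

lemma v_scale (a b : Fin n) (h : l a ≤ l b) :
    v l a * 2 ^ (l b - l a) = ∑ y ∈ P l a, 2 ^ (l b - l y) := by
  rw [v, Finset.sum_mul]
  refine Finset.sum_congr rfl fun y hy => ?_
  have := le_of_key l _ _ ((mem_P l a y).mp hy).2
  rw [← pow_add]; congr 1; omega

lemma v_step (a b : Fin n) (ha : l a ≠ 0) (h : key l a < key l b) :
    (v l a + 1) * 2 ^ (l b - l a) ≤ v l b := by
  rw [add_mul, v_scale l a b (le_of_key l a b h), one_mul, add_comm]
  have hn : a ∉ P l a := by simp [mem_P]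
  rw [← Finset.sum_insert (f := fun y => 2 ^ (l b - l y)) hn]
  refine Finset.sum_le_sum_of_subset ?_
  intro y hy
  rw [Finset.mem_insert, mem_P] at hy
  rw [mem_P]
  rcases hy with rfl | hy
  · exact ⟨ha, h⟩
  · exact ⟨hy.1, hy.2.trans h⟩

lemma v_lt (hl : ∑ i ∈ Finset.univ.filter (fun i : Fin n => l i ≠ 0), (1 / 2 : ℚ) ^ (l i) ≤ 1)
    (a : Fin n) : v l a < 2 ^ l a := by
  by_cases ha : l a = 0
  · have : P l a = ∅ := by
      ext y
      simp only [mem_P, Finset.notMem_empty, iff_false]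
      rintro ⟨h1, h2⟩
      have := le_of_key l _ _ h2
      omega
    simp [v, this]
  have hn : a ∉ P l a := by simp [mem_P]
  have h1 : ∑ i ∈ insert a (P l a), (1 / 2 : ℚ) ^ (l i) ≤ 1 := by
    refine le_trans (Finset.sum_le_sum_of_subset_of_nonneg ?_ ?_) hl
    · intro y hy
      rw [Finset.mem_insert, mem_P] at hy
      rcases hy with rfl | hy
      · simp [ha]
      · simp [hy.1]
    · intros; positivity
  have h2 : (v l a : ℚ) = 2 ^ l a * ∑ i ∈ P l a, (1 / 2 : ℚ) ^ (l i) := by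
    rw [v, Finset.mul_sum]
    push_cast
    refine Finset.sum_congr rfl fun y hy => ?_
    have := le_of_key l _ _ ((mem_P l a y).mp hy).2
    rw [pow_sub₀ _ two_ne_zero this]
    simp
  rw [Finset.sum_insert hn] at h1
  have h3 : (v l a : ℚ) < 2 ^ l a := by
    have hp : (0 : ℚ) < (1 / 2) ^ l a := by positivity
    rw [h2]
    exact mul_lt_of_lt_one_right (by positivity) (by linarith)
  exact_mod_cast h3

end DeflateAux

open DeflateAux

theorem existence {n : ℕ} (l : Fin n → ℕ)
    (hl : ∑ i ∈ Finset.univ.filter (fun i : Fin n => l i ≠ 0), (1 / 2 : ℚ) ^ (l i) ≤ 1) :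
    ∃ c : Fin n → List Bool, DeflateCoding c ∧ ∀ x : Fin n, (c x).length = l x := by
  have hv := v_lt l hl
  have hlen : ∀ x, (bits (l x) (v l x)).length = l x := fun x => length_bits _ _
  have hval : ∀ x, val (bits (l x) (v l x)) = v l x := fun x => val_bits _ _ (hv x)
  have hne : ∀ x, bits (l x) (v l x) ≠ [] ↔ l x ≠ 0 := fun x => by
    rw [← hlen x, Ne, Ne, List.length_eq_zero_iff, hlen]
  have hpre : ∀ a b, l a ≠ 0 → key l a < key l b →
      ¬ (bits (l a) (v l a) <+: bits (l b) (v l b)) := by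
    intro a b ha hab hp
    have h1 := of_prefix _ _ hp
    rw [hval, hval, hlen, hlen] at h1
    exact absurd (v_step l a b ha hab) (not_le.mpr h1)
  have hlex : ∀ a b, key l a < key l b → BitLex (bits (l a) (v l a)) (bits (l b) (v l b)) := by
    intro a b hab
    by_cases ha : l a = 0
    · rw [ha]; exact .nil _
    apply bitLex_of
    · rw [hlen, hlen]; exact le_of_key l a b hab
    · rw [hval, hval, hlen, hlen]
      refine le_trans ?_ (v_step l a b ha hab)
      gcongr
      omega
  refine ⟨fun x => bits (l x) (v l x), ⟨?_, ?_, ?_, ?_⟩, hlen⟩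
  · intro a b hab ha hp
    simp only at ha hp
    rw [hne] at ha
    rcases lt_trichotomy (key l a) (key l b) with h | h | h
    · exact hpre a b ha h hp
    · exact hab (key_inj l h)
    · have h1 := le_of_key l _ _ h
      have h2 := hp.length_le
      rw [hlen, hlen] at h2
      have h3 := hp.eq_of_length (by rw [hlen, hlen]; omega)
      refine hpre b a (by omega) h ?_
      rw [h3]
  · intro a b h
    simp only [hlen] at h
    exact hlex a b ((key_lt l a b).mpr (Or.inl h))
  · intro a b h hab
    simp only [hlen] at h
    rcases hab.lt_or_eq with h' | rfl
    · exact hlex a b ((key_lt l a b).mpr (Or.inr ⟨h, h'⟩))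
    · exact bitLex_of _ _ le_rfl (by simp)
  · intro a s hs hb hsl
    simp only at hb hsl
    have h1 := le_of_bitLex _ _ hb hsl
    rw [hval] at h1
    have h0 : l a ≠ 0 := by
      rw [hlen] at hsl
      rw [← hsl]
      simpa using hs
    rcases h1.lt_or_eq with h | h
    · obtain ⟨y, hy, h2, h3⟩ := locate (key l) (key_inj l) (fun y => 2 ^ (l a - l y)) (P l a)
        (val s) h
      rw [mem_P] at hy
      have hle := le_of_key l _ _ hy.2
      have e : (P l a).filter (fun z => key l z < key l y) = P l y := by
        ext z
        simp only [Finset.mem_filter, mem_P]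
        exact ⟨fun h => ⟨h.1.1, h.2⟩, fun h => ⟨⟨h.1, h.2.trans hy.2⟩, h.2⟩⟩
      rw [e, ← v_scale l y a hle] at h2 h3
      rw [hlen] at hsl
      refine ⟨y, (hne y).mpr hy.1, prefix_of _ _ ?_ ?_ ?_⟩
      · rw [hlen]; omega
      · rw [hval, hlen, hsl]; exact h2
      · rw [hval, hlen, hsl, add_mul, one_mul]; exact h3
    · refine ⟨a, (hne a).mpr h0, ?_⟩
      have := val_inj s _ hsl (by rw [hval]; exact h)
      show bits (l a) (v l a) <+: s
      rw [← this]
end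

section
/- Let l : Fin n → ℕ be a length function such that ∑_{i : Fin n, l i ≠ 0} (1/2)^(l i) ≤ 1 (a sum of rationals). Then there exists exactly one Deflate coding c on the alphabet Fin n such that for every x : Fin n, length (c x) = l x; that is, such a coding exists, and any two Deflate codings whose code lengths both equal l are pointwise equal. -/
namespace Defl

/-- The dyadic value of a bit string. -/
def q : List Bool → ℚ
  | [] => 0
  | b :: t => ((if b then 1 else 0) + q t) / 2

lemma q_nonneg (t : List Bool) : 0 ≤ q t := by
  induction t with
  | nil => simp [q]
  | cons b t ih => cases b <;> simp [q] <;> linarith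

lemma q_add (t : List Bool) : q t + (1 / 2 : ℚ) ^ t.length ≤ 1 := by
  induction t with
  | nil => simp [q]
  | cons b t ih =>
    rw [List.length_cons, pow_succ]
    cases b <;> simp only [q, if_true, Bool.false_eq_true, if_false] <;> linarith

lemma q_lt (t : List Bool) : q t < 1 := by
  have := q_add t
  have : (0 : ℚ) < (1 / 2 : ℚ) ^ t.length := by positivity
  linarith

lemma q_lex (a b : List Bool) (h : a.length ≤ b.length) (hq : q a ≤ q b) : BitLex a b := by
  induction a generalizing b with
  | nil => exact .nil _
  | cons i a ih =>
    cases b with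
    | nil => simp at h
    | cons j b =>
      have h' : a.length ≤ b.length := by simpa using h
      cases i <;> cases j <;> simp only [q, if_true, Bool.false_eq_true, if_false] at hq
      · exact .cons _ _ _ (ih b h' (by linarith))
      · exact .false_true _ _
      · have := q_lt b
        have := q_nonneg a
        linarith
      · exact .cons _ _ _ (ih b h' (by linarith))

lemma lex_q {a b : List Bool} (h : BitLex a b) : q a ≤ q b := by
  induction h with
  | nil b => exact q_nonneg b
  | false_true a b =>
    simp only [q, if_true, Bool.false_eq_true, if_false]
    have := q_lt a
    have := q_nonneg b
    linarith
  | cons j a b _ ih => simp only [q]; linarith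

lemma q_prefix (a b : List Bool) (h : a.length ≤ b.length) (h1 : q a ≤ q b)
    (h2 : q b < q a + (1 / 2 : ℚ) ^ a.length) : a <+: b := by
  induction a generalizing b with
  | nil => exact List.nil_prefix
  | cons i a ih =>
    cases b with
    | nil => simp at h
    | cons j b =>
      have h' : a.length ≤ b.length := by simpa using h
      have hb := q_lt b
      have hb0 := q_nonneg b
      have ha0 := q_nonneg a
      have ha := q_add a
      rw [List.length_cons, pow_succ] at h2
      rw [List.cons_prefix_cons]
      cases i <;> cases j <;> simp only [q, if_true, Bool.false_eq_true, if_false] at h1 h2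
      · exact ⟨rfl, ih b h' (by linarith) (by linarith)⟩
      · linarith
      · linarith
      · exact ⟨rfl, ih b h' (by linarith) (by linarith)⟩

lemma q_append (a c : List Bool) : q (a ++ c) = q a + (1 / 2 : ℚ) ^ a.length * q c := by
  induction a with
  | nil => simp [q]
  | cons i a ih =>
    rw [List.cons_append, List.length_cons, pow_succ]
    simp only [q, ih]
    ring

lemma prefix_q {a b : List Bool} (h : a <+: b) :
    q a ≤ q b ∧ q b < q a + (1 / 2 : ℚ) ^ a.length := by
  obtain ⟨c, rfl⟩ := h
  rw [q_append]
  have h0 : (0 : ℚ) < (1 / 2 : ℚ) ^ a.length := by positivity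
  have := q_lt c
  have := q_nonneg c
  constructor <;> nlinarith

lemma q_inj {a b : List Bool} (h : a.length = b.length) (hq : q a = q b) : a = b := by
  have h0 : (0 : ℚ) < (1 / 2 : ℚ) ^ a.length := by positivity
  exact (q_prefix a b h.le hq.le (by linarith)).eq_of_length h

lemma exists_q (L k : ℕ) (h : k < 2 ^ L) :
    ∃ t : List Bool, t.length = L ∧ q t = k * (1 / 2 : ℚ) ^ L := by
  induction L generalizing k with
  | zero => exact ⟨[], rfl, by simp at h; simp [h, q]⟩
  | succ L ih =>
    rw [pow_succ] at h
    have e : (2 : ℚ) ^ L * (1 / 2) ^ L = 1 := by rw [← mul_pow]; norm_num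
    by_cases hk : k < 2 ^ L
    · obtain ⟨t, h1, h2⟩ := ih k hk
      refine ⟨false :: t, by simp [h1], ?_⟩
      simp only [q, h2, Bool.false_eq_true, if_false, pow_succ]
      ring
    · obtain ⟨m, rfl⟩ := Nat.exists_eq_add_of_le (not_lt.mp hk)
      obtain ⟨t, h1, h2⟩ := ih m (by omega)
      refine ⟨true :: t, by simp [h1], ?_⟩
      simp only [q, h2, if_true]
      push_cast
      rw [pow_succ]
      linear_combination (-1 / 2) * e

lemma cover {ι κ : Type*} [DecidableEq ι] [LinearOrder κ] (f : ι → κ)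
    (hf : Function.Injective f) (w : ι → ℚ) (T : Finset ι) (x : ℚ) (hx0 : 0 ≤ x)
    (hx : x < ∑ i ∈ T, w i) :
    ∃ b ∈ T, ∑ i ∈ T.filter (fun i => f i < f b), w i ≤ x ∧
      x < ∑ i ∈ T.filter (fun i => f i < f b), w i + w b := by
  induction T using Finset.induction_on_max_value f with
  | empty => simp at hx; linarith
  | insert a s has hmax ih =>
    have hlt : ∀ y ∈ s, f y < f a := fun y hy =>
      lt_of_le_of_ne (hmax y hy) (fun h => has (hf h ▸ hy))
    by_cases hxs : x < ∑ i ∈ s, w i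
    · obtain ⟨b, hb, h1⟩ := ih hxs
      refine ⟨b, Finset.mem_insert_of_mem hb, ?_⟩
      rw [Finset.filter_insert, if_neg (not_lt.mpr (hlt b hb).le)]
      exact h1
    · refine ⟨a, Finset.mem_insert_self _ _, ?_⟩
      rw [Finset.filter_insert, if_neg (lt_irrefl _), Finset.filter_true_of_mem hlt]
      rw [Finset.sum_insert has] at hx
      exact ⟨not_lt.mp hxs, by linarith⟩

/-- The sorting key: length, then index. -/
def key {n : ℕ} (l : Fin n → ℕ) (a : Fin n) : ℕ ×ₗ Fin n := toLex (l a, a)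

lemma key_lt {n : ℕ} (l : Fin n → ℕ) (a b : Fin n) :
    key l a < key l b ↔ l a < l b ∨ l a = l b ∧ a < b := by
  simp [key, Prod.Lex.toLex_lt_toLex]

lemma key_inj {n : ℕ} (l : Fin n → ℕ) : Function.Injective (key l) := by
  intro a b h
  simp [key] at h
  exact h.2

lemma key_le {n : ℕ} {l : Fin n → ℕ} {a b : Fin n} (h : key l a < key l b) : l a ≤ l b := by
  rcases (key_lt l a b).1 h with h | h
  · exact h.le
  · exact h.1.le

/-- Nonzero-length letters preceding `a`. -/
def E {n : ℕ} (l : Fin n → ℕ) (a : Fin n) : Finset (Fin n) :=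
  Finset.univ.filter (fun b => l b ≠ 0 ∧ key l b < key l a)

def S {n : ℕ} (l : Fin n → ℕ) (a : Fin n) : ℚ := ∑ b ∈ E l a, (1 / 2 : ℚ) ^ l b

lemma S_nat {n : ℕ} (l : Fin n → ℕ) (a : Fin n) : ∃ k : ℕ, S l a = k * (1 / 2 : ℚ) ^ l a := by
  refine ⟨∑ b ∈ E l a, 2 ^ (l a - l b), ?_⟩
  rw [S]
  push_cast
  rw [Finset.sum_mul]
  refine Finset.sum_congr rfl fun b hb => ?_
  have hle : l b ≤ l a := key_le (Finset.mem_filter.1 hb).2.2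
  obtain ⟨m, hm⟩ := Nat.exists_eq_add_of_le hle
  rw [hm, Nat.add_sub_cancel_left, pow_add]
  have e : (2 : ℚ) ^ m * (1 / 2) ^ m = 1 := by rw [← mul_pow]; norm_num
  linear_combination (-(1 / 2 : ℚ) ^ l b) * e

lemma S_add_le {n : ℕ} (l : Fin n → ℕ) (a : Fin n) (T : Finset (Fin n)) (haT : a ∈ T)
    (hT : E l a ⊆ T) : S l a + (1 / 2 : ℚ) ^ l a ≤ ∑ b ∈ T, (1 / 2 : ℚ) ^ l b := by
  have ha : a ∉ E l a := by simp [E]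
  rw [S, add_comm, ← Finset.sum_insert (f := fun b => (1 / 2 : ℚ) ^ l b) ha]
  refine Finset.sum_le_sum_of_subset_of_nonneg (Finset.insert_subset haT hT) ?_
  intros; positivity

lemma S_step {n : ℕ} (l : Fin n → ℕ) (a b : Fin n) (h0 : l a ≠ 0) (h : key l a < key l b) :
    S l a + (1 / 2 : ℚ) ^ l a ≤ S l b := by
  refine S_add_le l a _ (by simp [E, h0, h]) ?_
  intro x hx
  simp only [E, Finset.mem_filter, Finset.mem_univ, true_and] at hx ⊢
  exact ⟨hx.1, hx.2.trans h⟩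

lemma S_mono {n : ℕ} (l : Fin n → ℕ) (a b : Fin n) (h : key l a ≤ key l b) :
    S l a ≤ S l b := by
  refine Finset.sum_le_sum_of_subset_of_nonneg ?_ ?_
  · intro x hx
    simp only [E, Finset.mem_filter, Finset.mem_univ, true_and] at hx ⊢
    exact ⟨hx.1, hx.2.trans_le h⟩
  · intros; positivity

lemma S_cover {n : ℕ} (l : Fin n → ℕ) (a : Fin n) (x : ℚ) (h0 : 0 ≤ x) (hx : x < S l a) :
    ∃ b, l b ≠ 0 ∧ key l b < key l a ∧ S l b ≤ x ∧ x < S l b + (1 / 2 : ℚ) ^ l b := by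
  obtain ⟨b, hb, h⟩ := cover (key l) (key_inj l) (fun b => (1 / 2 : ℚ) ^ l b) (E l a) x h0 hx
  have hb' : l b ≠ 0 ∧ key l b < key l a := by simpa [E] using hb
  have e : (E l a).filter (fun i => key l i < key l b) = E l b := by
    ext i
    simp only [E, Finset.mem_filter, Finset.mem_univ, true_and]
    constructor
    · rintro ⟨⟨h1, _⟩, h2⟩; exact ⟨h1, h2⟩
    · rintro ⟨h1, h2⟩; exact ⟨⟨h1, h2.trans hb'.2⟩, h2⟩
  rw [e] at h
  exact ⟨b, hb'.1, hb'.2, h⟩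

lemma exists_code {n : ℕ} (l : Fin n → ℕ)
    (hl : ∑ i ∈ Finset.univ.filter (fun i : Fin n => l i ≠ 0), (1 / 2 : ℚ) ^ (l i) ≤ 1)
    (a : Fin n) : ∃ t : List Bool, t.length = l a ∧ q t = S l a := by
  by_cases h0 : l a = 0
  · refine ⟨[], by simp [h0], ?_⟩
    have : E l a = ∅ := by
      ext b
      simp only [E, Finset.mem_filter, Finset.mem_univ, true_and, Finset.notMem_empty, iff_false]
      rintro ⟨h1, h2⟩
      have := key_le h2
      omega
    simp [q, S, this]
  · obtain ⟨k, hk⟩ := S_nat l a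
    have h1 : S l a + (1 / 2 : ℚ) ^ l a ≤ 1 := by
      refine (S_add_le l a _ (by simp [h0]) ?_).trans hl
      intro x hx
      simp only [E, Finset.mem_filter, Finset.mem_univ, true_and] at hx ⊢
      exact hx.1
    have hp : (0 : ℚ) < (1 / 2 : ℚ) ^ l a := by positivity
    have hkl : k < 2 ^ l a := by
      by_contra hc
      have hc' : (2 : ℚ) ^ l a ≤ k := by exact_mod_cast not_lt.mp hc
      have e : (2 : ℚ) ^ l a * (1 / 2) ^ l a = 1 := by rw [← mul_pow]; norm_num
      nlinarith
    obtain ⟨t, h2, h3⟩ := exists_q _ _ hkl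
    exact ⟨t, h2, by rw [h3, hk]⟩

lemma existence {n : ℕ} (l : Fin n → ℕ) (c : Fin n → List Bool)
    (hlen : ∀ a, (c a).length = l a) (hq : ∀ a, q (c a) = S l a) : DeflateCoding c := by
  have hne : ∀ a, c a ≠ [] ↔ l a ≠ 0 := fun a => by
    rw [← hlen, Ne, Ne, List.length_eq_zero_iff]
  refine ⟨?_, ?_, ?_, ?_⟩
  · intro a b hab ha hp
    have hle := hp.length_le
    obtain ⟨h1, h2⟩ := prefix_q hp
    rw [hlen, hlen] at hle
    rw [hq, hq] at h1 h2
    rw [hlen] at h2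
    have ha0 := (hne a).1 ha
    rcases lt_trichotomy (key l a) (key l b) with h | h | h
    · have := S_step l a b ha0 h
      linarith
    · exact hab (key_inj l h)
    · have e : l b = l a := le_antisymm (key_le h) hle
      have := S_step l b a (e ▸ ha0) h
      have : (0 : ℚ) < (1 / 2 : ℚ) ^ l b := by positivity
      linarith
  · intro a b h
    refine q_lex _ _ h.le ?_
    rw [hq, hq]
    rw [hlen, hlen] at h
    exact S_mono l a b ((key_lt l a b).2 (.inl h)).le
  · intro a b h hab
    refine q_lex _ _ h.le ?_
    rw [hq, hq]
    rw [hlen, hlen] at h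
    rcases hab.eq_or_lt with rfl | hab
    · exact le_rfl
    · exact S_mono l a b ((key_lt l a b).2 (.inr ⟨h, hab⟩)).le
  · intro a t ht hlex htl
    have h1 := lex_q hlex
    rcases h1.eq_or_lt with h1 | h1
    · have := q_inj htl h1
      subst this
      exact ⟨a, ht, List.prefix_rfl⟩
    · rw [hq] at h1
      obtain ⟨b, hb0, hb, h2, h3⟩ := S_cover l a _ (q_nonneg t) h1
      refine ⟨b, (hne b).2 hb0, q_prefix _ _ ?_ ?_ ?_⟩
      · rw [htl, hlen, hlen]; exact key_le hb
      · rw [hq]; exact h2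
      · rw [hq, hlen]; exact h3

lemma not_lt_aux {n : ℕ} (l : Fin n → ℕ) (c d : Fin n → List Bool) (hc : DeflateCoding c)
    (hd : DeflateCoding d) (hcl : ∀ a, (c a).length = l a) (hdl : ∀ a, (d a).length = l a)
    (a : Fin n) (ih : ∀ b, key l b < key l a → c b = d b) : ¬ q (c a) < q (d a) := by
  intro h
  have hlen : (c a).length = (d a).length := by rw [hcl, hdl]
  have hne : c a ≠ [] := by
    intro h0
    rw [h0] at hlen
    have : d a = [] := List.length_eq_zero_iff.1 hlen.symm
    rw [h0, this] at h
    exact lt_irrefl _ h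
  obtain ⟨b, hb0, hb⟩ := hd.2.2.2 a (c a) hne (q_lex _ _ hlen.le h.le) hlen
  rcases lt_trichotomy (key l b) (key l a) with hk | hk | hk
  · rw [← ih b hk] at hb hb0
    exact hc.1 b a (fun e => by simp [e] at hk) hb0 hb
  · have e := key_inj l hk
    subst e
    rw [hb.eq_of_length hlen.symm] at h
    exact lt_irrefl _ h
  · have hle := hb.length_le
    rw [hdl, hcl] at hle
    have e : l b = l a := le_antisymm hle (key_le hk)
    have hba : a < b := by
      rcases (key_lt l a b).1 hk with h | h
      · omega
      · exact h.2
    have e2 : d b = c a := hb.eq_of_length (by rw [hdl, hcl, e])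
    have := lex_q (hd.2.2.1 a b (by rw [hdl, hdl, e]) hba.le)
    rw [e2] at this
    linarith

lemma uniq {n : ℕ} (l : Fin n → ℕ) (c d : Fin n → List Bool) (hc : DeflateCoding c)
    (hd : DeflateCoding d) (hcl : ∀ a, (c a).length = l a) (hdl : ∀ a, (d a).length = l a)
    (a : Fin n) : c a = d a := by
  induction a using (InvImage.wf (key l) wellFounded_lt).induction with
  | _ a ih =>
    have h1 := not_lt_aux l c d hc hd hcl hdl a ih
    have h2 := not_lt_aux l d c hd hc hdl hcl a (fun b hb => (ih b hb).symm)
    exact q_inj (by rw [hcl, hdl]) (le_antisymm (not_lt.mp h2) (not_lt.mp h1))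

end Defl

theorem existence_unique {n : ℕ} (l : Fin n → ℕ)
    (hl : ∑ i ∈ Finset.univ.filter (fun i : Fin n => l i ≠ 0), (1 / 2 : ℚ) ^ (l i) ≤ 1) :
    ∃! c : Fin n → List Bool, DeflateCoding c ∧ ∀ x : Fin n, (c x).length = l x := by
  choose c h1 h2 using Defl.exists_code l hl
  refine ⟨c, ⟨Defl.existence l c h1 h2, h1⟩, ?_⟩
  rintro d ⟨hd, hdl⟩
  funext a
  exact Defl.uniq l d c hd (Defl.existence l c h1 h2) hdl h1 a
end

section
/- Let c be a Deflate coding on the alphabet Fin n, and let a b : Fin n with a ≤ b and length (c a) = length (c b). If l is a bit string with length l = length (c a), c a ⊑ l and l ⊑ c b, then there exists d : Fin n with c d = l. In other words, the codes of any given length in a Deflate coding are lexicographically consecutive. -/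
theorem BitLex.prefix_of_between {p l x : List Bool} (hp : p <+: l)
    (h₁ : BitLex p x) (h₂ : BitLex x l) : p <+: x := by
  induction h₁ generalizing l with
  | nil b => exact List.nil_prefix
  | false_true a b =>
    obtain ⟨t, rfl⟩ := hp
    cases h₂
  | cons j a b h ih =>
    obtain ⟨t, rfl⟩ := hp
    have h₃ : BitLex b (a ++ t) := by
      cases h₂
      assumption
    exact (List.prefix_cons_inj j).2 (ih (List.prefix_append a t) h₃)

theorem codes_consecutive {n : ℕ} (c : Fin n → List Bool) (hc : DeflateCoding c)
    (a b : Fin n) (hab : a ≤ b) (hlen : (c a).length = (c b).length)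
    (l : List Bool) (hl : l.length = (c a).length)
    (h₁ : BitLex (c a) l) (h₂ : BitLex l (c b)) :
    ∃ d : Fin n, c d = l := by
  obtain ⟨H1, H2, _, H4⟩ := hc
  by_cases hn : l = []
  · subst hn
    exact ⟨a, List.length_eq_zero_iff.1 hl.symm⟩
  obtain ⟨d, hd, hpre⟩ := H4 b l hn h₂ (hl.trans hlen)
  refine ⟨d, ?_⟩
  by_contra hne
  have hlt : (c d).length < (c a).length := by
    rw [← hl]
    exact lt_of_le_of_ne hpre.length_le (fun h => hne (hpre.eq_of_length h))
  have hda : d ≠ a := by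
    rintro rfl
    exact lt_irrefl _ hlt
  exact H1 d a hda hd (BitLex.prefix_of_between hpre (H2 d a hlt) h₁)
end

section
/- Strong uniqueness is preserved by the bind combinator: let Q : B → List S → Prop and R : B → C → List S → Prop be relations and f : B → C → D a combining function, and define the bind relation (Q ≫= R) x l to hold iff there exist b_q : B, b_r : C and lists a_q, a_r : List S with Q b_q a_q, R b_q b_r a_r, x = f b_q b_r and l = a_q ++ a_r. If Q is strongly unique, R b is strongly unique for every b : B, and f is injective in the sense that f b q = f b' q' → b = b' ∧ q = q' (e.g., f is pairing), then Q ≫= R is strongly unique. -/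
/-- An encoding relation `R : A → List S → Prop` is strongly unique. -/
def StrongUnique {A S : Type*} (R : A → List S → Prop) : Prop :=
  ∀ (a b : A) (la la' lb lb' : List S),
    la ++ la' = lb ++ lb' → R a la → R b lb → a = b ∧ la = lb

/-- The bind combinator on encoding relations. -/
def BindRel {B C D S : Type*} (Q : B → List S → Prop) (R : B → C → List S → Prop)
    (f : B → C → D) : D → List S → Prop :=
  fun x l => ∃ (b_q : B) (b_r : C) (a_q a_r : List S),
    Q b_q a_q ∧ R b_q b_r a_r ∧ x = f b_q b_r ∧ l = a_q ++ a_r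

theorem strongUnique_bind {B C D S : Type*} (Q : B → List S → Prop)
    (R : B → C → List S → Prop) (f : B → C → D)
    (hQ : StrongUnique Q) (hR : ∀ b : B, StrongUnique (R b))
    (hf : ∀ (b b' : B) (q q' : C), f b q = f b' q' → b = b' ∧ q = q') :
    StrongUnique (BindRel Q R f) := by
  rintro x y la la' lb lb' h ⟨b, c, q, r, hq, hr, rfl, rfl⟩ ⟨b', c', q', r', hq', hr', rfl, rfl⟩
  rw [List.append_assoc, List.append_assoc] at h
  obtain ⟨rfl, rfl⟩ := hQ _ _ _ _ _ _ h hq hq'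
  obtain ⟨rfl, rfl⟩ := hR _ _ _ _ _ _ _ (List.append_cancel_left h) hr hr'
  exact ⟨rfl, rfl⟩
end
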